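/- For each p ≥ 2, let 𝒯_p denote the class of measurable tests T : ℝ^p → [0,1] that are permutation invariant, i.e., T(x_{σ(1)}, …, x_{σ(p)}) = T(x_1, …, x_p) for every permutation σ of {1, …, p} and every x ∈ ℝ^p. For β ∈ ℝ^p define Power(T, β) = ∫ T dN(β, I_p), Level(T) = ∫ T dN(0, I_p), and β̄ = (1/p) Σ_{j=1}^p β_j. Fix a constant Δ > 0 and let (ε_p) be any sequence of positive reals with ε_p → 0, and define C_p = { β ∈ ℝ^p : ‖β‖₂ ≤ Δ and |β̄| ≤ ε_p/√p }. Then sup_{T ∈ 𝒯_p, β ∈ C_p} |Power(T, β) − Level(T)| → 0 as p → ∞. -/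

import Mathlib

open MeasureTheory ProbabilityTheory Filter Real

/-- The Gaussian measure `N(m, I_p)` on `ℝ^p` with mean vector `m` and identity covariance,
as the product of one-dimensional Gaussians. -/
noncomputable def gaussianPi (p : ℕ) (m : Fin p → ℝ) : Measure (Fin p → ℝ) :=
  Measure.pi fun j => gaussianReal (m j) 1

/-- A measurable, `[0,1]`-valued, permutation-invariant test on `ℝ^p`. -/
def IsPermInvariantTest (p : ℕ) (T : (Fin p → ℝ) → ℝ) : Prop :=
  Measurable T ∧ (∀ x, T x ∈ Set.Icc (0 : ℝ) 1) ∧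
    ∀ σ : Equiv.Perm (Fin p), ∀ x : Fin p → ℝ, T (fun i => x (σ i)) = T x

/-- `C_p`: vectors `β ∈ ℝ^p` with `‖β‖₂ ≤ Δ` and mean coordinate `|β̄| ≤ ε_p/√p`. -/
def smallMeanBall (p : ℕ) (Δ εp : ℝ) : Set (Fin p → ℝ) :=
  {β | Real.sqrt (∑ j, β j ^ 2) ≤ Δ ∧
    |(1 / (p : ℝ)) * ∑ j, β j| ≤ εp / Real.sqrt p}

/-- one dimensional likelihood ratio -/
noncomputable def lr1 (a x : ℝ) : ℝ := Real.exp (a * x - a ^ 2 / 2)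

lemma lr1_meas (a : ℝ) : Measurable (lr1 a) := by unfold lr1; fun_prop

lemma lr1_pos (a x : ℝ) : 0 < lr1 a x := Real.exp_pos _

lemma lr1_eq (a x : ℝ) : lr1 a x = Real.exp (a * x) * Real.exp (-(a ^ 2 / 2)) := by
  unfold lr1; rw [← Real.exp_add]; ring_nf

lemma lr1_integrable (a : ℝ) : Integrable (lr1 a) (gaussianReal 0 1) := by
  have : lr1 a = fun x => Real.exp (a * x) * Real.exp (-(a ^ 2 / 2)) := funext (lr1_eq a)
  rw [this]
  exact (integrable_exp_mul_gaussianReal a).mul_const _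

lemma integral_exp_gauss (a : ℝ) : ∫ x, Real.exp (a * x) ∂(gaussianReal 0 1) = Real.exp (a ^ 2 / 2) := by
  have := mgf_gaussianReal (p := gaussianReal 0 1) (X := id) (μ := 0) (v := 1) (by simp) a
  simpa [mgf] using this

lemma lr1_integral (a : ℝ) : ∫ x, lr1 a x ∂(gaussianReal 0 1) = 1 := by
  simp_rw [lr1_eq]
  rw [integral_mul_const, integral_exp_gauss, ← Real.exp_add]; simp

lemma lr1_mul (a b x : ℝ) : lr1 a x * lr1 b x = Real.exp (a * b) * lr1 (a + b) x := by
  unfold lr1; rw [← Real.exp_add, ← Real.exp_add]; ring_nf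

lemma gaussianReal_withDensity_lr1 (a : ℝ) :
    (gaussianReal 0 1).withDensity (fun x => ENNReal.ofReal (lr1 a x)) = gaussianReal a 1 := by
  rw [gaussianReal_of_var_ne_zero _ one_ne_zero, gaussianReal_of_var_ne_zero _ one_ne_zero,
    ← withDensity_mul _ (measurable_gaussianPDF _ _) (lr1_meas a).ennreal_ofReal]
  congr 1
  ext x
  simp only [Pi.mul_apply, gaussianPDF]
  rw [← ENNReal.ofReal_mul (gaussianPDFReal_nonneg _ _ _)]
  congr 1
  simp only [gaussianPDFReal, lr1, mul_assoc, ← Real.exp_add]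
  congr 2
  simp
  ring

/-- product likelihood ratio -/
noncomputable def lr {p : ℕ} (m : Fin p → ℝ) (x : Fin p → ℝ) : ℝ := ∏ j, lr1 (m j) (x j)

lemma lr_meas {p : ℕ} (m : Fin p → ℝ) : Measurable (lr m) := by
  unfold lr
  exact Finset.measurable_prod _ fun j _ => (lr1_meas (m j)).comp (measurable_pi_apply j)

lemma lr_nonneg {p : ℕ} (m x : Fin p → ℝ) : 0 ≤ lr m x :=
  Finset.prod_nonneg fun j _ => (lr1_pos _ _).le

instance gaussianPi_prob (p : ℕ) (m : Fin p → ℝ) : IsProbabilityMeasure (gaussianPi p m) := by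
  unfold gaussianPi; infer_instance

lemma lr_integrable {p : ℕ} (m : Fin p → ℝ) : Integrable (lr m) (gaussianPi p 0) := by
  unfold gaussianPi lr
  exact Integrable.fintype_prod fun j => lr1_integrable (m j)

lemma lr_integral {p : ℕ} (m : Fin p → ℝ) : ∫ x, lr m x ∂(gaussianPi p 0) = 1 := by
  unfold gaussianPi lr
  rw [integral_fintype_prod_eq_prod (f := fun j x => lr1 (m j) x)]
  simp [lr1_integral]

lemma lr_mul {p : ℕ} (m n x : Fin p → ℝ) :
    lr m x * lr n x = Real.exp (∑ j, m j * n j) * lr (m + n) x := by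
  unfold lr
  rw [Real.exp_sum, ← Finset.prod_mul_distrib, ← Finset.prod_mul_distrib]
  exact Finset.prod_congr rfl fun j _ => lr1_mul _ _ _

lemma gaussianPi_withDensity {p : ℕ} (m : Fin p → ℝ) :
    (gaussianPi p 0).withDensity (fun x => ENNReal.ofReal (lr m x)) = gaussianPi p m := by
  symm
  apply Measure.pi_eq
  intro s hs
  rw [withDensity_apply _ (MeasurableSet.univ_pi hs)]
  rw [← ofReal_integral_eq_lintegral_ofReal (lr_integrable m).integrableOn
    (Eventually.of_forall (lr_nonneg m))]
  have h1 : (gaussianPi p 0).restrict (Set.univ.pi s)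
      = Measure.pi fun j => (gaussianReal 0 1).restrict (s j) := by
    unfold gaussianPi
    rw [Measure.restrict_pi_pi]; rfl
  rw [h1]
  unfold lr
  rw [integral_fintype_prod_eq_prod (f := fun j x => lr1 (m j) x),
    ENNReal.ofReal_prod_of_nonneg
      (fun j _ => integral_nonneg fun x => (lr1_pos _ _).le)]
  refine Finset.prod_congr rfl fun j _ => ?_
  rw [← gaussianReal_withDensity_lr1 (m j), withDensity_apply _ (hs j),
    ← ofReal_integral_eq_lintegral_ofReal (lr1_integrable _).integrableOn
    (Eventually.of_forall fun x => (lr1_pos _ _).le)]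

lemma integral_gaussianPi {p : ℕ} (m : Fin p → ℝ) (T : (Fin p → ℝ) → ℝ) :
    ∫ x, T x ∂(gaussianPi p m) = ∫ x, lr m x * T x ∂(gaussianPi p 0) := by
  rw [← gaussianPi_withDensity m, integral_withDensity_eq_integral_toReal_smul
    (lr_meas m).ennreal_ofReal (by simp)]
  refine integral_congr_ae (Eventually.of_forall fun x => ?_)
  simp [ENNReal.toReal_ofReal (lr_nonneg m x)]

lemma integral_perm {p : ℕ} (m : Fin p → ℝ) (T : (Fin p → ℝ) → ℝ)
    (hT : IsPermInvariantTest p T) (σ : Equiv.Perm (Fin p)) :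
    ∫ x, T x ∂(gaussianPi p (fun i => m (σ i))) = ∫ x, T x ∂(gaussianPi p m) := by
  have h := measurePreserving_piCongrLeft (fun j => gaussianReal (m j) 1) σ
  have h2 := h.integral_comp' T
  unfold gaussianPi
  rw [← h2]
  refine integral_congr_ae (Eventually.of_forall fun x => ?_)
  simp only
  rw [← hT.2.2 σ (MeasurableEquiv.piCongrLeft _ σ x)]
  congr 1
  ext i
  exact (MeasurableEquiv.piCongrLeft_apply_apply σ (β := fun _ => ℝ) x i).symm

lemma exp_quad (K y : ℝ) (h : |y| ≤ K) : Real.exp y ≤ 1 + y + y ^ 2 * Real.exp K := by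
  have hK : 0 ≤ K := (abs_nonneg y).trans h
  have h1 : Real.exp y * (1 - y) ≤ 1 := by
    have := Real.add_one_le_exp (-y)
    calc Real.exp y * (1 - y) ≤ Real.exp y * Real.exp (-y) := by
          apply mul_le_mul_of_nonneg_left _ (Real.exp_pos _).le; linarith
      _ = 1 := by rw [← Real.exp_add]; simp
  have h2 : 1 ≤ Real.exp K := Real.one_le_exp hK
  have h3 : Real.exp y ≤ Real.exp K := Real.exp_le_exp.2 ((le_abs_self y).trans h)
  have h4 := Real.add_one_le_exp y
  rcases le_total 0 y with hy | hy
  · nlinarith [mul_nonneg hy hy, mul_nonneg hy (sub_nonneg.2 h1), mul_nonneg (mul_nonneg hy hy) (sub_nonneg.2 h3)]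
  · nlinarith [mul_nonneg (neg_nonneg.2 hy) (sub_nonneg.2 h4), mul_nonneg (sq_nonneg y) (sub_nonneg.2 h2)]

section perm
variable {p : ℕ}

lemma sum_perm_one (f : Fin p → ℝ) (j : Fin p) :
    (p : ℝ) * ∑ σ : Equiv.Perm (Fin p), f (σ j)
      = Fintype.card (Equiv.Perm (Fin p)) * ∑ l, f l := by
  have h : ∀ l, ∑ σ : Equiv.Perm (Fin p), f (σ l) = ∑ σ : Equiv.Perm (Fin p), f (σ j) := by
    intro l
    rw [← Equiv.sum_comp (Equiv.mulRight (Equiv.swap j l))]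
    simp
  calc (p : ℝ) * ∑ σ : Equiv.Perm (Fin p), f (σ j)
      = ∑ l, ∑ σ : Equiv.Perm (Fin p), f (σ l) := by simp [h]
    _ = ∑ σ : Equiv.Perm (Fin p), ∑ l, f (σ l) := Finset.sum_comm
    _ = ∑ σ : Equiv.Perm (Fin p), ∑ l, f l :=
        Finset.sum_congr rfl fun σ _ => Equiv.sum_comp σ f
    _ = _ := by simp

lemma sum_perm_two (f : Fin p → ℝ) (j k : Fin p) (hjk : k ≠ j) :
    (p : ℝ) * (p - 1) * ∑ σ : Equiv.Perm (Fin p), f (σ j) * f (σ k)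
      = Fintype.card (Equiv.Perm (Fin p)) * ((∑ l, f l) ^ 2 - ∑ l, f l ^ 2) := by
  have h : ∀ l, l ≠ j → ∑ σ : Equiv.Perm (Fin p), f (σ j) * f (σ l)
      = ∑ σ : Equiv.Perm (Fin p), f (σ j) * f (σ k) := by
    intro l hl
    rw [← Equiv.sum_comp (Equiv.mulRight (Equiv.swap k l))]
    simp [Equiv.swap_apply_of_ne_of_ne hjk.symm hl.symm]
  have hp : 1 ≤ p := by have := j.2; omega
  have h2 : ((p : ℝ) - 1) * ∑ σ : Equiv.Perm (Fin p), f (σ j) * f (σ k)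
      = ∑ l ∈ Finset.univ.erase j, ∑ σ : Equiv.Perm (Fin p), f (σ j) * f (σ l) := by
    rw [Finset.sum_congr rfl fun l hl => h l (Finset.ne_of_mem_erase hl)]
    simp [Nat.cast_sub hp]
  have h3 : ∑ l ∈ Finset.univ.erase j, ∑ σ : Equiv.Perm (Fin p), f (σ j) * f (σ l)
      = (∑ l, f l) * ∑ σ : Equiv.Perm (Fin p), f (σ j) - ∑ σ : Equiv.Perm (Fin p), f (σ j) ^ 2 := by
    rw [Finset.sum_comm, Finset.mul_sum, ← Finset.sum_sub_distrib]
    refine Finset.sum_congr rfl fun σ _ => ?_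
    rw [← Finset.mul_sum, ← Equiv.sum_comp σ f,
      ← Finset.add_sum_erase Finset.univ (fun l => f (σ l)) (Finset.mem_univ j)]
    ring
  have e1 := sum_perm_one f j
  have e2 := sum_perm_one (fun l => f l ^ 2) j
  rw [mul_assoc, h2, h3, mul_sub, e2, mul_left_comm, e1]
  ring

lemma sum_Y (f : Fin p → ℝ) :
    (p : ℝ) * ∑ σ : Equiv.Perm (Fin p), ∑ j, f j * f (σ j)
      = Fintype.card (Equiv.Perm (Fin p)) * (∑ l, f l) ^ 2 := by
  rw [Finset.sum_comm, Finset.mul_sum]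
  have : ∀ j, (p : ℝ) * ∑ σ : Equiv.Perm (Fin p), f j * f (σ j)
      = f j * (Fintype.card (Equiv.Perm (Fin p)) * ∑ l, f l) := by
    intro j
    rw [← sum_perm_one f j, ← Finset.mul_sum]; ring
  simp_rw [this]
  rw [← Finset.sum_mul]; ring

lemma sum_Y2 (f : Fin p → ℝ) :
    (p : ℝ) * (p - 1) * ∑ σ : Equiv.Perm (Fin p), (∑ j, f j * f (σ j)) ^ 2
      = Fintype.card (Equiv.Perm (Fin p)) * ((p - 1) * (∑ l, f l ^ 2) ^ 2 +
        ((∑ l, f l) ^ 2 - ∑ l, f l ^ 2) ^ 2) := by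
  set N : ℝ := (Fintype.card (Equiv.Perm (Fin p)) : ℝ)
  set S := ∑ l, f l ^ 2 with hS
  set M := ∑ l, f l with hM
  have h1 : ∀ j k, (p : ℝ) * (p - 1) * ∑ σ : Equiv.Perm (Fin p), f (σ j) * f (σ k)
      = if k = j then N * ((p - 1) * S) else N * (M ^ 2 - S) := by
    intro j k
    split_ifs with h
    · subst h
      have := sum_perm_one (fun l => f l ^ 2) k
      simp only [← pow_two]
      linear_combination ((p : ℝ) - 1) * this
    · exact sum_perm_two f j k h
  have h2 : ∑ σ : Equiv.Perm (Fin p), (∑ j, f j * f (σ j)) ^ 2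
      = ∑ j, ∑ k, f j * f k * ∑ σ : Equiv.Perm (Fin p), f (σ j) * f (σ k) := by
    simp_rw [pow_two, Finset.sum_mul_sum, Finset.mul_sum]
    rw [Finset.sum_comm]
    refine Finset.sum_congr rfl fun j _ => ?_
    rw [Finset.sum_comm]
    refine Finset.sum_congr rfl fun k _ => Finset.sum_congr rfl fun σ _ => by ring
  have h3 : ∀ j, ∑ k, f j * f k * (if k = j then N * ((p - 1) * S) else N * (M ^ 2 - S))
      = f j * M * (N * (M ^ 2 - S)) + f j ^ 2 * (N * ((p - 1) * S) - N * (M ^ 2 - S)) := by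
    intro j
    have : ∀ k, f j * f k * (if k = j then N * ((p - 1) * S) else N * (M ^ 2 - S))
      = f j * f k * (N * (M ^ 2 - S)) +
        if k = j then f j ^ 2 * (N * ((p - 1) * S) - N * (M ^ 2 - S)) else 0 := by
      intro k
      split_ifs with h
      · subst h; ring
      · ring
    simp_rw [this, Finset.sum_add_distrib, ← Finset.sum_mul, ← Finset.mul_sum]
    simp [hM]
  calc _ = ∑ j, ∑ k, f j * f k * ((p : ℝ) * (p - 1) * ∑ σ : Equiv.Perm (Fin p), f (σ j) * f (σ k)) := by
        rw [h2]
        simp_rw [Finset.mul_sum]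
        refine Finset.sum_congr rfl fun j _ => Finset.sum_congr rfl fun k _ =>
          Finset.sum_congr rfl fun σ _ => by ring
    _ = _ := by
        simp_rw [h1, h3, Finset.sum_add_distrib, ← Finset.sum_mul, ← hM, ← hS]
        ring

end perm

lemma diff_sq_le {p : ℕ} (β : Fin p → ℝ) (T : (Fin p → ℝ) → ℝ) (hT : IsPermInvariantTest p T) :
    ((∫ x, T x ∂(gaussianPi p β)) - ∫ x, T x ∂(gaussianPi p 0)) ^ 2
      ≤ (Fintype.card (Equiv.Perm (Fin p)) : ℝ)⁻¹ *
        ∑ σ : Equiv.Perm (Fin p), Real.exp (∑ j, β j * β (σ j)) - 1 := by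
  set N : ℝ := (Fintype.card (Equiv.Perm (Fin p)) : ℝ) with hN
  have hN0 : N ≠ 0 := by simp [hN, Fintype.card_ne_zero]
  set μ := gaussianPi p 0
  let w : Equiv.Perm (Fin p) → (Fin p → ℝ) → ℝ := fun σ => lr (fun i => β (σ i))
  have hw : ∀ σ, Integrable (w σ) μ := fun σ => lr_integrable _
  have hw1 : ∀ σ, ∫ x, w σ x ∂μ = 1 := fun σ => lr_integral _
  have hTb : ∀ x, ‖T x‖ ≤ 1 := fun x => by
    rw [Real.norm_eq_abs, abs_of_nonneg (hT.2.1 x).1]; exact (hT.2.1 x).2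
  have hTm : AEStronglyMeasurable T μ := hT.1.aestronglyMeasurable
  have hTi : Integrable T μ := Integrable.of_bound hTm 1 (Eventually.of_forall hTb)
  have hwT : ∀ σ, Integrable (fun x => w σ x * T x) μ := fun σ =>
    (hw σ).mul_bdd hTm (c := 1) (Eventually.of_forall hTb)
  have hww : ∀ σ τ, (fun x => w σ x * w τ x) =
      fun x => Real.exp (∑ j, β (σ j) * β (τ j)) * lr ((fun i => β (σ i)) + fun i => β (τ i)) x :=
    fun σ τ => funext fun x => lr_mul _ _ x
  have hwwi : ∀ σ τ, Integrable (fun x => w σ x * w τ x) μ := fun σ τ => by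
    rw [hww]; exact (lr_integrable _).const_mul _
  have hww1 : ∀ σ τ, ∫ x, w σ x * w τ x ∂μ = Real.exp (∑ j, β (σ j) * β (τ j)) := fun σ τ => by
    rw [hww, integral_const_mul, lr_integral, mul_one]
  let L : (Fin p → ℝ) → ℝ := fun x => N⁻¹ * ∑ σ, w σ x
  have hL : Integrable L μ := (integrable_finsetSum _ fun σ _ => hw σ).const_mul _
  have hL1 : ∫ x, L x ∂μ = 1 := by
    simp only [L]
    rw [integral_const_mul, integral_finsetSum _ fun σ _ => hw σ]
    simp [hw1, ← hN, hN0]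
  have hL2e : (fun x => L x ^ 2) = fun x => N⁻¹ ^ 2 * ∑ σ, ∑ τ, w σ x * w τ x := by
    funext x; simp only [L]; rw [mul_pow, pow_two (∑ σ, w σ x), Finset.sum_mul_sum]
  have hL2i : Integrable (fun x => L x ^ 2) μ := by
    rw [hL2e]
    exact (integrable_finsetSum _ fun σ _ => integrable_finsetSum _ fun τ _ => hwwi σ τ).const_mul _
  have hL2 : ∫ x, L x ^ 2 ∂μ = N⁻¹ * ∑ σ : Equiv.Perm (Fin p), Real.exp (∑ j, β j * β (σ j)) := by
    rw [hL2e, integral_const_mul, integral_finsetSum _ fun σ _ =>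
      integrable_finsetSum _ fun τ _ => hwwi σ τ]
    have : ∀ σ, ∫ x, ∑ τ, w σ x * w τ x ∂μ
        = ∑ τ : Equiv.Perm (Fin p), Real.exp (∑ j, β j * β (τ j)) := by
      intro σ
      rw [integral_finsetSum _ fun τ _ => hwwi σ τ]
      simp_rw [hww1]
      rw [← Equiv.sum_comp (Equiv.mulRight σ)]
      refine Finset.sum_congr rfl fun τ _ => ?_
      congr 1
      exact Equiv.sum_comp σ (fun j => β j * β (τ j))
    simp_rw [this]
    rw [Finset.sum_const, Finset.card_univ, nsmul_eq_mul, ← hN]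
    field_simp
  have hLT : Integrable (fun x => L x * T x) μ :=
    hL.mul_bdd hTm (c := 1) (Eventually.of_forall hTb)
  have hpow : ∫ x, T x ∂(gaussianPi p β) = ∫ x, L x * T x ∂μ := by
    have h1 : ∀ σ, ∫ x, w σ x * T x ∂μ = ∫ x, T x ∂(gaussianPi p β) := fun σ => by
      rw [← integral_perm β T hT σ, integral_gaussianPi (fun i => β (σ i))]
    have h2 : (fun x => L x * T x) = fun x => N⁻¹ * ∑ σ, w σ x * T x := by
      funext x; simp only [L]; rw [mul_assoc, Finset.sum_mul]
    rw [h2, integral_const_mul, integral_finsetSum _ fun σ _ => hwT σ]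
    simp_rw [h1]
    rw [Finset.sum_const, Finset.card_univ, nsmul_eq_mul, ← hN]
    field_simp
  rw [hpow, ← hL2]
  set D := (∫ x, L x * T x ∂μ) - ∫ x, T x ∂μ with hD
  have i1 : Integrable (fun x => 2 * D * (L x * T x - T x)) μ := (hLT.sub hTi).const_mul _
  have i2 : Integrable (fun x => L x ^ 2 - 2 * L x + (1 + D ^ 2)) μ :=
    (hL2i.sub (hL.const_mul 2)).add (integrable_const _)
  have key := integral_mono i1 i2 (fun x => by
    have ht := hT.2.1 x
    have ht2 : T x ^ 2 ≤ 1 := by nlinarith [ht.1, ht.2]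
    simp only
    nlinarith [sq_nonneg (D - T x * (L x - 1)), mul_nonneg (sq_nonneg (L x - 1)) (sub_nonneg.2 ht2)])
  rw [integral_const_mul, integral_sub hLT hTi, ← hD,
    integral_add (f := fun x => L x ^ 2 - 2 * L x) (hL2i.sub (hL.const_mul 2)) (integrable_const _),
    integral_sub hL2i (hL.const_mul 2), integral_const_mul, hL1] at key
  simp at key
  linarith

lemma main_bound {p : ℕ} (hp : 2 ≤ p) (Δ e : ℝ) (hΔ : 0 < Δ) (β : Fin p → ℝ)
    (hβ : β ∈ smallMeanBall p Δ e) (T : (Fin p → ℝ) → ℝ) (hT : IsPermInvariantTest p T) :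
    |(∫ x, T x ∂(gaussianPi p β)) - ∫ x, T x ∂(gaussianPi p 0)|
      ≤ Real.sqrt (e ^ 2 + (5 * Δ ^ 4 / p + 4 * e ^ 4) * Real.exp (Δ ^ 2)) := by
  apply Real.abs_le_sqrt
  refine (diff_sq_le β T hT).trans ?_
  obtain ⟨h1, h2⟩ := hβ
  set N : ℝ := (Fintype.card (Equiv.Perm (Fin p)) : ℝ) with hN
  have hN0 : 0 < N := by simp [hN, Fintype.card_pos]
  have hY1 := sum_Y β
  have hY2 := sum_Y2 β
  set S := ∑ l, β l ^ 2 with hS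
  set M := ∑ l, β l with hM
  have hS0 : 0 ≤ S := Finset.sum_nonneg fun _ _ => sq_nonneg _
  have hSΔ : S ≤ Δ ^ 2 := by
    rw [← Real.sq_sqrt hS0]; exact pow_le_pow_left₀ (Real.sqrt_nonneg _) h1 2
  have hpR : (2 : ℝ) ≤ p := by exact_mod_cast hp
  have hp0 : (0 : ℝ) < p := by linarith
  have hM2 : M ^ 2 ≤ p * e ^ 2 := by
    have h3 := pow_le_pow_left₀ (abs_nonneg _) h2 2
    rw [sq_abs, mul_pow, div_pow e, Real.sq_sqrt hp0.le] at h3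
    have : (p : ℝ) ^ 2 * ((1 / (p : ℝ)) ^ 2 * M ^ 2) ≤ p ^ 2 * (e ^ 2 / p) :=
      mul_le_mul_of_nonneg_left h3 (by positivity)
    field_simp at this
    linarith
  have hYb : ∀ σ : Equiv.Perm (Fin p), |∑ j, β j * β (σ j)| ≤ Δ ^ 2 := by
    intro σ
    have e1 : ∑ j, β (σ j) ^ 2 = S := Equiv.sum_comp σ (fun j => β j ^ 2)
    have e2 : ∑ j, (β j ^ 2 + β (σ j) ^ 2) / 2 = S := by
      rw [← Finset.sum_div, Finset.sum_add_distrib, e1, ← hS]; ring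
    refine le_trans ?_ hSΔ
    rw [← e2]
    refine (Finset.abs_sum_le_sum_abs _ _).trans (Finset.sum_le_sum fun j _ => ?_)
    rw [abs_le]
    constructor <;> nlinarith [sq_nonneg (β j - β (σ j)), sq_nonneg (β j + β (σ j))]
  have hexp : ∑ σ : Equiv.Perm (Fin p), Real.exp (∑ j, β j * β (σ j))
      ≤ N + ∑ σ : Equiv.Perm (Fin p), ∑ j, β j * β (σ j)
        + (∑ σ : Equiv.Perm (Fin p), (∑ j, β j * β (σ j)) ^ 2) * Real.exp (Δ ^ 2) := by
    refine (Finset.sum_le_sum fun σ _ => exp_quad _ _ (hYb σ)).trans (le_of_eq ?_)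
    rw [Finset.sum_add_distrib, Finset.sum_add_distrib, Finset.sum_mul]
    simp [hN]
  set A := ∑ σ : Equiv.Perm (Fin p), ∑ j, β j * β (σ j)
  set B := ∑ σ : Equiv.Perm (Fin p), (∑ j, β j * β (σ j)) ^ 2
  have hA : A ≤ N * e ^ 2 := by
    have : p * A ≤ p * (N * e ^ 2) := by
      rw [hY1]; nlinarith
    exact le_of_mul_le_mul_left this hp0
  have hB : B ≤ N * (5 * Δ ^ 4 / p + 4 * e ^ 4) := by
    have hpp : 0 < (p : ℝ) * (p - 1) := mul_pos hp0 (by linarith)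
    refine le_of_mul_le_mul_left ?_ hpp
    rw [hY2, mul_left_comm]
    refine mul_le_mul_of_nonneg_left ?_ hN0.le
    have a1 : S ^ 2 ≤ Δ ^ 4 := by nlinarith
    have a2 : (M ^ 2) ^ 2 ≤ p ^ 2 * e ^ 4 := by
      have := pow_le_pow_left₀ (sq_nonneg M) hM2 2
      nlinarith
    have a3 : (M ^ 2 - S) ^ 2 ≤ 2 * p ^ 2 * e ^ 4 + 2 * Δ ^ 4 := by
      nlinarith [sq_nonneg (M ^ 2 + S)]
    have a4 : (p : ℝ) * (p - 1) * (5 * Δ ^ 4 / p + 4 * e ^ 4)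
        = (p - 1) * (5 * Δ ^ 4) + 4 * (p * (p - 1)) * e ^ 4 := by
      field_simp
    rw [a4]
    have a5 : (p - 1) * S ^ 2 ≤ (p - 1) * Δ ^ 4 := mul_le_mul_of_nonneg_left a1 (by linarith)
    have a6 : (p : ℝ) ^ 2 ≤ 2 * (p * (p - 1)) := by nlinarith
    have a7 : (p : ℝ) ^ 2 * e ^ 4 ≤ 2 * (p * (p - 1)) * e ^ 4 :=
      mul_le_mul_of_nonneg_right a6 (by positivity)
    have a8 : 1 * Δ ^ 4 ≤ (p - 1) * Δ ^ 4 := mul_le_mul_of_nonneg_right (by linarith) (by positivity)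
    have a9 : 0 ≤ Δ ^ 4 := by positivity
    linarith
  have hE := Real.exp_pos (Δ ^ 2)
  have hfin : ∑ σ : Equiv.Perm (Fin p), Real.exp (∑ j, β j * β (σ j))
      ≤ N * (1 + e ^ 2 + (5 * Δ ^ 4 / p + 4 * e ^ 4) * Real.exp (Δ ^ 2)) := by
    have := mul_le_mul_of_nonneg_right hB hE.le
    linarith
  have := mul_le_mul_of_nonneg_left hfin (inv_nonneg.2 hN0.le)
  rw [inv_mul_cancel_left₀ hN0.ne'] at this
  linarith

/-- For any fixed `Δ > 0` and any positive sequence `ε_p → 0`,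
`sup_{T ∈ 𝒯_p, β ∈ C_p} |Power(T, β) − Level(T)| → 0`: permutation-invariant tests cannot
distinguish `N(0, I_p)` from alternatives in an `O(1)` Euclidean ball with suitably small
mean coordinate. -/
theorem stmt14 (Δ : ℝ) (hΔ : 0 < Δ) (ε : ℕ → ℝ) (hε : ∀ p, 0 < ε p)
    (hε0 : Tendsto ε atTop (nhds 0)) :
    Tendsto
      (fun p : ℕ =>
        ⨆ q : {q : ((Fin p → ℝ) → ℝ) × (Fin p → ℝ) //
            IsPermInvariantTest p q.1 ∧ q.2 ∈ smallMeanBall p Δ (ε p)},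
          |(∫ x, q.1.1 x ∂(gaussianPi p q.1.2)) - ∫ x, q.1.1 x ∂(gaussianPi p 0)|)
      atTop (nhds 0) := by
  have hlim : Tendsto (fun p : ℕ => Real.sqrt (ε p ^ 2 +
      (5 * Δ ^ 4 / (p : ℝ) + 4 * ε p ^ 4) * Real.exp (Δ ^ 2))) atTop (nhds 0) := by
    have h1 : Tendsto (fun p : ℕ => 5 * Δ ^ 4 / (p : ℝ)) atTop (nhds 0) :=
      tendsto_const_div_atTop_nhds_zero_nat _
    have h2 := ((hε0.pow 2).add ((h1.add ((hε0.pow 4).const_mul 4)).mul_const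
      (Real.exp (Δ ^ 2)))).sqrt
    simpa using h2
  refine tendsto_of_tendsto_of_tendsto_of_le_of_le' tendsto_const_nhds hlim
    (Eventually.of_forall fun p => Real.iSup_nonneg fun q => abs_nonneg _) ?_
  filter_upwards [eventually_ge_atTop 2] with p hp
  exact Real.iSup_le (fun q => main_bound hp Δ (ε p) hΔ q.1.2 q.2.2 q.1.1 q.2.1)
    (Real.sqrt_nonneg _)
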